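/- arXiv:1312.2727 — 3 statements merged into one kernel-verified Lean document; each statement's English description precedes it below -/
import Mathlib

section
/- For every n ≥ 1, the homogeneous degree-n solutions of the functional equation form a ℂ-vector space of dimension exactly 2^{n−1} (the number of compositions of n). That is, the degree-n homogeneous component of Sol has dimension 2^{n−1}. -/
open MvPolynomial

/-- Sequences of polynomials: the `n`-th term is thought of as a polynomial in
`x_1, …, x_n` (variable `j : ℕ` corresponds to `x_{j+1}`). -/
abbrev PolySeq : Type := (n : ℕ) → MvPolynomial ℕ ℂ

/-- The algebra morphism substituting `0` for the variable `x_{n+1}` (index `n`). -/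
noncomputable def killVar (n : ℕ) : MvPolynomial ℕ ℂ →ₐ[ℂ] MvPolynomial ℕ ℂ :=
  aeval (fun j => if j = n then 0 else X j)

/-- `f` is a *stable polynomial*: `f n` only involves `x_1, …, x_n` and setting the last
variable of `f (n+1)` to zero gives back `f n`. -/
def IsStable (f : PolySeq) : Prop :=
  (∀ n, f n ∈ supported ℂ (Set.Iio n)) ∧ ∀ n, killVar n (f (n + 1)) = f n

/-- The substitution `x_{j+2} := x_{j+1}` (0-based : variable `j+1` is replaced by variable `j`). -/
noncomputable def collapse (j : ℕ) : MvPolynomial ℕ ℂ →ₐ[ℂ] MvPolynomial ℕ ℂ :=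
  aeval (fun k => if k = j + 1 then X j else X k)

/-- Renaming of variables skipping the two indices `j`, `j+1`. -/
noncomputable def skip2 (j : ℕ) : MvPolynomial ℕ ℂ →ₐ[ℂ] MvPolynomial ℕ ℂ :=
  rename (fun k => if k < j then k else k + 2)

/-- The functional equation (1) of the paper: substituting `x_{i+1} = x_i` in `f_n` yields
`f_{n-2} (x_1, …, x_{i-1}, x_{i+2}, …, x_n)`. -/
def IsSol (f : PolySeq) : Prop :=
  IsStable f ∧ ∀ n j : ℕ, j + 2 ≤ n → collapse j (f n) = skip2 j (f (n - 2))

/-- Homogeneity of degree `d` for a stable polynomial. -/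
def IsHomogSeq (f : PolySeq) (d : ℕ) : Prop := ∀ n, (f n).IsHomogeneous d

private lemma homog_smul {p : MvPolynomial ℕ ℂ} {d : ℕ} (c : ℂ) (h : p.IsHomogeneous d) :
    (c • p).IsHomogeneous d := by
  rw [smul_eq_C_mul]
  simpa using (isHomogeneous_C ℕ c).mul h

/-- The homogeneous component of degree `d` of the space of solutions of the
functional equation, as a `ℂ`-vector space. -/
noncomputable def SolHomog (d : ℕ) : Submodule ℂ PolySeq where
  carrier := {f | IsSol f ∧ IsHomogSeq f d}
  zero_mem' := by
    refine ⟨⟨⟨fun n => Subalgebra.zero_mem _, fun n => by simp only [Pi.zero_apply, map_zero]⟩,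
      fun n j _ => by simp only [Pi.zero_apply, map_zero]⟩, fun n => isHomogeneous_zero _ _ _⟩
  add_mem' := by
    rintro a b ⟨⟨⟨ha1, ha2⟩, ha3⟩, ha4⟩ ⟨⟨⟨hb1, hb2⟩, hb3⟩, hb4⟩
    refine ⟨⟨⟨fun n => Subalgebra.add_mem _ (ha1 n) (hb1 n), fun n => ?_⟩, fun n j h => ?_⟩,
      fun n => (ha4 n).add (hb4 n)⟩
    · simp only [Pi.add_apply, map_add, ha2 n, hb2 n]
    · simp only [Pi.add_apply, map_add, ha3 n j h, hb3 n j h]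
  smul_mem' := by
    rintro c a ⟨⟨⟨ha1, ha2⟩, ha3⟩, ha4⟩
    refine ⟨⟨⟨fun n => Subalgebra.smul_mem _ (ha1 n) c, fun n => ?_⟩, fun n j h => ?_⟩,
      fun n => homog_smul c (ha4 n)⟩
    · simp only [Pi.smul_apply, map_smul, ha2 n]
    · simp only [Pi.smul_apply, map_smul, ha3 n j h]

/-! ### Substitutions and coefficients -/

lemma coeff_killVar {n : ℕ} (p : MvPolynomial ℕ ℂ) :
    ∀ e : ℕ →₀ ℕ, e n = 0 → coeff e (killVar n p) = coeff e p := by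
  induction p using MvPolynomial.induction_on with
  | C a => intro e _; simp [killVar]
  | add p q hp hq => intro e he; simp [hp e he, hq e he]
  | mul_X p i ih =>
    intro e he
    by_cases hi : i = n
    · subst hi
      simp [killVar, coeff_mul_X', he]
    · have : killVar n (X i) = X i := by simp [killVar, hi]
      rw [map_mul, this, coeff_mul_X', coeff_mul_X']
      split_ifs
      · exact ih _ (by simp [he])
      · rfl

lemma collapse_eq_rename (j : ℕ) :
    collapse j = rename (fun k => if k = j + 1 then j else k) := by
  ext1 k
  simp only [collapse, aeval_X, rename_X]
  split_ifs <;> rfl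

lemma exists_ne_mapDomain_eq_of_rename_eq_zero {σ : ℕ → ℕ} {p : MvPolynomial ℕ ℂ}
    (hp : rename σ p = 0) {e : ℕ →₀ ℕ} (he : e ∈ p.support) :
    ∃ e' ∈ p.support, e' ≠ e ∧ e'.mapDomain σ = e.mapDomain σ := by
  by_contra! h
  have h0 : coeff (e.mapDomain σ) (rename σ p) = coeff e p := by
    conv_lhs => rw [← p.support_sum_monomial_coeff]
    rw [map_sum, coeff_sum, Finset.sum_eq_single e]
    · simp [rename_monomial]
    · intro e' he' hne
      rw [rename_monomial, coeff_monomial, if_neg (h e' he' hne)]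
    · intro h'; exact absurd he h'
  rw [hp, coeff_zero] at h0
  exact mem_support_iff.mp he h0.symm

lemma linearCombination_lt_of_mapDomain_eq {j : ℕ} {e e' : ℕ →₀ ℕ} (hj : e j = 0) (hne : e' ≠ e)
    (h : e'.mapDomain (fun k => if k = j + 1 then j else k) =
      e.mapDomain (fun k => if k = j + 1 then j else k)) :
    Finsupp.linearCombination ℕ (fun i : ℕ => i) e' <
      Finsupp.linearCombination ℕ (fun i : ℕ => i) e := by
  set σ : ℕ → ℕ := fun k => if k = j + 1 then j else k with hσ
  have key (g : ℕ → ℕ) : Finsupp.linearCombination ℕ (g ∘ σ) e' =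
      Finsupp.linearCombination ℕ (g ∘ σ) e := by
    rw [← Finsupp.linearCombination_mapDomain, ← Finsupp.linearCombination_mapDomain, h]
  have hadd (g g' : ℕ → ℕ) (x : ℕ →₀ ℕ) : Finsupp.linearCombination ℕ (fun i => g i + g' i) x =
      Finsupp.linearCombination ℕ g x + Finsupp.linearCombination ℕ g' x := by
    simp [Finsupp.linearCombination_apply, Finsupp.sum, mul_add, Finset.sum_add_distrib]
  have hdelta (a : ℕ) (x : ℕ →₀ ℕ) :
      Finsupp.linearCombination ℕ (fun i => if i = a then 1 else 0) x = x a := by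
    simp [Finsupp.linearCombination_apply, Finsupp.sum]
    tauto
  have hid : (fun i : ℕ => i) = fun i => σ i + if i = j + 1 then 1 else 0 := by
    funext i
    simp only [hσ]
    split_ifs <;> omega
  have hother (a : ℕ) (h1 : a ≠ j) (h2 : a ≠ j + 1) : e' a = e a := by
    have h3 := key (fun i => if i = a then 1 else 0)
    have h4 : (fun i => if i = a then 1 else 0) ∘ σ = fun i => if i = a then 1 else 0 := by
      funext i
      simp only [hσ, Function.comp]
      split_ifs <;> omega
    rwa [h4, hdelta, hdelta] at h3
  have hsum : e' j + e' (j + 1) = e j + e (j + 1) := by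
    have h3 := key (fun i => if i = j then 1 else 0)
    have h4 : (fun i => if i = j then 1 else 0) ∘ σ =
        fun i => (if i = j then 1 else 0) + if i = j + 1 then 1 else 0 := by
      funext i
      simp only [hσ, Function.comp]
      split_ifs <;> omega
    rwa [h4, hadd, hadd, hdelta, hdelta, hdelta, hdelta] at h3
  have hlt : e' (j + 1) < e (j + 1) := by
    by_contra! hle
    apply hne
    ext a
    by_cases h1 : a = j
    · subst h1; omega
    by_cases h2 : a = j + 1
    · subst h2; omega
    exact hother a h1 h2
  have h5 := key id
  rw [hid, hadd, hadd, hdelta, hdelta]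
  simp only [Function.id_comp] at h5
  omega

/-! ### A solution is determined by its coefficients with full support -/

lemma lt_of_mem_support_of_supported {p : MvPolynomial ℕ ℂ} {n : ℕ}
    (hp : p ∈ supported ℂ (Set.Iio n)) {e : ℕ →₀ ℕ} (he : e ∈ p.support) {j : ℕ} (hj : e j ≠ 0) :
    j < n :=
  mem_supported.mp hp
    (Finset.mem_coe.mpr ((mem_vars_iff_mem_support j).mpr ⟨e, he, Finsupp.mem_support_iff.mpr hj⟩))

lemma IsSol.eq_zero_of_coeff_eq_zero {f : PolySeq} (hf : IsSol f)
    (h : ∀ (k : ℕ) (e : ℕ →₀ ℕ), (∀ j, e j ≠ 0 ↔ j < k) → coeff e (f k) = 0) (k : ℕ) :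
    f k = 0 := by
  induction k using Nat.strong_induction_on with
  | _ k ih =>
  by_contra hk
  obtain ⟨e, he, hmin⟩ := Finset.exists_min_image (f k).support
    (Finsupp.linearCombination ℕ (fun i : ℕ => i)) (support_nonempty.mpr hk)
  have hlt (j : ℕ) (hj : e j ≠ 0) : j < k := lt_of_mem_support_of_supported (hf.1.1 k) he hj
  obtain ⟨j, hjk, hj⟩ : ∃ j, j < k ∧ e j = 0 := by
    by_contra! hfull
    exact mem_support_iff.mp he (h k e fun j => ⟨hlt j, hfull j⟩)
  rcases Nat.lt_or_ge (j + 1) k with hjk' | hjk'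
  · have hc := hf.2 k j hjk'
    rw [ih (k - 2) (by omega), map_zero, collapse_eq_rename] at hc
    obtain ⟨e', he', hne, hmap⟩ := exists_ne_mapDomain_eq_of_rename_eq_zero hc he
    exact absurd (linearCombination_lt_of_mapDomain_eq hj hne hmap) (not_lt.mpr (hmin e' he'))
  · obtain rfl : k = j + 1 := by omega
    have hc := coeff_killVar (f (j + 1)) e hj
    rw [hf.1.2 j, ih j (by omega), coeff_zero] at hc
    exact mem_support_iff.mp he hc.symm

/-- The coefficients of a solution at the monomials `x_1 ^ c_1 ⋯ x_k ^ c_k`, for `c` a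
composition of `d` with `k` parts. -/
noncomputable def compositionCoeff (d : ℕ) : SolHomog d →ₗ[ℂ] (Composition d → ℂ) where
  toFun f c := coeff c.blocks.toFinsupp (f.1 c.length)
  map_add' f g := by ext c; simp
  map_smul' a f := by ext c; simp

lemma exists_composition_toFinsupp_eq {d k : ℕ} {e : ℕ →₀ ℕ} (he : ∀ j, e j ≠ 0 ↔ j < k)
    (hd : e.degree = d) : ∃ c : Composition d, c.length = k ∧ c.blocks.toFinsupp = e := by
  have hsupp : e.support = Finset.range k := by ext j; simp [he]
  refine ⟨⟨(List.range k).map e, ?_, ?_⟩, ?_, ?_⟩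
  · intro i hi
    obtain ⟨j, hj, rfl⟩ := List.mem_map.mp hi
    exact Nat.pos_of_ne_zero ((he j).mpr (List.mem_range.mp hj))
  · rw [← hd, Finsupp.degree_apply, hsupp, Finset.sum_range, ← List.sum_ofFn]
    congr 1
    exact List.ext_getElem (by simp) (by simp)
  · simp [Composition.length]
  · ext j
    by_cases hj : j < k
    · simp [hj]
    · have : e j = 0 := by by_contra h; exact hj ((he j).mp h)
      simp [hj, this]

lemma compositionCoeff_injective (d : ℕ) : Function.Injective (compositionCoeff d) := by
  rw [injective_iff_map_eq_zero]
  rintro ⟨f, hsol, hhom⟩ hf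
  ext1
  funext k
  refine hsol.eq_zero_of_coeff_eq_zero (fun k e he => ?_) k
  by_contra hne
  have hd : e.degree = d := by
    by_contra hd
    exact hne ((hhom k).coeff_eq_zero hd)
  obtain ⟨c, rfl, rfl⟩ := exists_composition_toFinsupp_eq he hd
  exact hne (congrFun hf c)

/-! ### Monomial quasisymmetric functions of the alphabet `x_1 ⊖ x_2 ⊕ x_3 ⊖ ⋯` -/

/-- The monomial quasisymmetric function attached to the reverse of the list of exponents, evaluated
on the virtual alphabet `x_1 ⊖ x_2 ⊕ x_3 ⊖ ⋯` with `n` letters. -/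
noncomputable def altMonomial : List ℕ → PolySeq
  | [], _ => 1
  | _ :: _, 0 => 0
  | i :: I, n + 1 => altMonomial (i :: I) n +
      if Even n then X n ^ i * altMonomial I n else -(X n ^ i * altMonomial I (n + 1))
termination_by I n => (I.length, n)

lemma altMonomial_nil (n : ℕ) : altMonomial [] n = 1 := by rw [altMonomial]

lemma altMonomial_cons_zero (i : ℕ) (I : List ℕ) : altMonomial (i :: I) 0 = 0 := by
  rw [altMonomial]

lemma altMonomial_cons_succ (i : ℕ) (I : List ℕ) (n : ℕ) :
    altMonomial (i :: I) (n + 1) = altMonomial (i :: I) n +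
      if Even n then X n ^ i * altMonomial I n else -(X n ^ i * altMonomial I (n + 1)) := by
  rw [altMonomial]

lemma altMonomial_mem_supported (I : List ℕ) (n : ℕ) :
    altMonomial I n ∈ supported ℂ (Set.Iio n) := by
  induction I generalizing n with
  | nil => rw [altMonomial_nil]; exact one_mem _
  | cons i I ihI =>
    induction n with
    | zero => rw [altMonomial_cons_zero]; exact zero_mem _
    | succ n ihn =>
      have hmono : supported ℂ (Set.Iio n) ≤ supported ℂ (Set.Iio (n + 1)) :=
        supported_mono (Set.Iio_subset_Iio n.le_succ)
      have hX : (X n ^ i : MvPolynomial ℕ ℂ) ∈ supported ℂ (Set.Iio (n + 1)) :=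
        pow_mem (X_mem_supported.mpr (Set.mem_Iio.mpr n.lt_succ_self)) i
      rw [altMonomial_cons_succ]
      refine add_mem (hmono ihn) ?_
      split_ifs
      · exact mul_mem hX (hmono (ihI n))
      · exact neg_mem (mul_mem hX (ihI (n + 1)))

lemma altMonomial_isHomogeneous (I : List ℕ) (n : ℕ) :
    (altMonomial I n).IsHomogeneous I.sum := by
  induction I generalizing n with
  | nil => rw [altMonomial_nil]; exact isHomogeneous_one _ _
  | cons i I ihI =>
    induction n with
    | zero => rw [altMonomial_cons_zero]; exact isHomogeneous_zero _ _ _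
    | succ n ihn =>
      have hX (m : ℕ) : (X n ^ i * altMonomial I m).IsHomogeneous (i :: I).sum := by
        rw [List.sum_cons]
        exact (isHomogeneous_X_pow n i).mul (ihI m)
      rw [altMonomial_cons_succ]
      refine ihn.add ?_
      split_ifs
      · exact hX n
      · exact (hX (n + 1)).neg

lemma map_eq_self_of_mem_supported {φ : MvPolynomial ℕ ℂ →ₐ[ℂ] MvPolynomial ℕ ℂ} {s : Set ℕ}
    (hφ : ∀ i ∈ s, φ (X i) = X i) {p : MvPolynomial ℕ ℂ} (hp : p ∈ supported ℂ s) : φ p = p := by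
  have : supported ℂ s ≤ AlgHom.equalizer φ (AlgHom.id ℂ _) := by
    refine Algebra.adjoin_le ?_
    rintro _ ⟨i, hi, rfl⟩
    exact hφ i hi
  exact this hp

lemma killVar_altMonomial {I : List ℕ} (hI : ∀ i ∈ I, 0 < i) (n : ℕ) :
    killVar n (altMonomial I (n + 1)) = altMonomial I n := by
  cases I with
  | nil => simp [altMonomial_nil]
  | cons i I =>
    have hi : i ≠ 0 := (hI i List.mem_cons_self).ne'
    have hX : killVar n (X n) = 0 := by simp [killVar]
    have hself : killVar n (altMonomial (i :: I) n) = altMonomial (i :: I) n :=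
      map_eq_self_of_mem_supported (fun j hj => by simp [killVar, (Set.mem_Iio.mp hj).ne])
        (altMonomial_mem_supported _ n)
    rw [altMonomial_cons_succ, map_add, hself]
    split_ifs <;> simp [hX, hi]

lemma collapse_altMonomial (I : List ℕ) (j m : ℕ) :
    collapse j (altMonomial I (j + 2 + m)) = skip2 j (altMonomial I (j + m)) := by
  induction I generalizing m with
  | nil => simp [altMonomial_nil]
  | cons i I ihI =>
    have hcol (L : List ℕ) : collapse j (altMonomial L j) = altMonomial L j :=
      map_eq_self_of_mem_supported
        (fun k hk => by simp [collapse, ((Set.mem_Iio.mp hk).trans j.lt_succ_self).ne])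
        (altMonomial_mem_supported _ j)
    have hcol1 : collapse j (altMonomial I (j + 1)) = altMonomial I (j + 1) :=
      map_eq_self_of_mem_supported
        (fun k hk => by simp [collapse, (Set.mem_Iio.mp hk).ne])
        (altMonomial_mem_supported _ (j + 1))
    have hskip (L : List ℕ) : skip2 j (altMonomial L j) = altMonomial L j :=
      map_eq_self_of_mem_supported
        (fun k hk => by simp [skip2, Set.mem_Iio.mp hk])
        (altMonomial_mem_supported _ j)
    induction m with
    | zero =>
      have hX : collapse j (X j) = X j := by simp [collapse]
      have hX1 : collapse j (X (j + 1)) = X j := by simp [collapse]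
      have hI := ihI 0
      rw [add_zero, add_zero, hskip] at hI ⊢
      rw [altMonomial_cons_succ, altMonomial_cons_succ]
      by_cases hj : Even j
      · simp [hj, Nat.even_add_one, hcol, hX, hX1, hI]
      · simp [hj, Nat.even_add_one, hcol, hX, hX1, hcol1]
    | succ m ihm =>
      have hX : collapse j (X (j + 2 + m)) = skip2 j (X (j + m)) := by
        simp [collapse, skip2]
        grind
      have hpar : Even (j + 2 + m) ↔ Even (j + m) := by grind
      have hI := ihI (m + 1)
      rw [← add_assoc, ← add_assoc] at hI ⊢
      rw [altMonomial_cons_succ, altMonomial_cons_succ, map_add, map_add, ihm]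
      by_cases hj : Even (j + m)
      · simp [hj, hpar, hX, ihI m]
      · simp [hj, hpar, hX, hI]

lemma altMonomial_mem_solHomog {I : List ℕ} (hI : ∀ i ∈ I, 0 < i) :
    altMonomial I ∈ SolHomog I.sum := by
  refine ⟨⟨⟨altMonomial_mem_supported I, killVar_altMonomial hI⟩, fun n j h => ?_⟩,
    altMonomial_isHomogeneous I⟩
  obtain ⟨m, rfl⟩ := Nat.exists_eq_add_of_le h
  rw [collapse_altMonomial]
  congr 2
  omega

/-! ### Linear independence -/

/-- The exponent of `x_1 ^ j_1 x_3 ^ j_2 x_5 ^ j_3 ⋯`, for the list `[…, j_3, j_2, j_1]`. -/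
noncomputable def oddExponent : List ℕ → (ℕ →₀ ℕ)
  | [] => 0
  | j :: J => oddExponent J + Finsupp.single (2 * J.length) j

lemma oddExponent_apply_eq_zero (J : List ℕ) {k : ℕ} (hk : 2 * J.length ≤ k + 1) :
    oddExponent J k = 0 := by
  induction J with
  | nil => simp [oddExponent]
  | cons j J ih =>
    rw [List.length_cons] at hk
    rw [oddExponent, Finsupp.add_apply, ih (by omega), Finsupp.single_eq_of_ne (by omega), add_zero]

lemma coeff_oddExponent_altMonomial {J : List ℕ} (hJ : ∀ j ∈ J, 0 < j) {I : List ℕ}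
    (hI : ∀ i ∈ I, 0 < i) :
    coeff (oddExponent J) (altMonomial I (2 * J.length)) = if I = J then 1 else 0 := by
  induction J generalizing I with
  | nil =>
    cases I with
    | nil => simp [oddExponent, altMonomial_nil]
    | cons i I => simp [altMonomial_cons_zero]
  | cons j J ih =>
    have hj : 0 < j := hJ j List.mem_cons_self
    have hlast : oddExponent (j :: J) (2 * J.length) = j := by
      simp [oddExponent, oddExponent_apply_eq_zero J (Nat.le_succ _)]
    cases I with
    | nil =>
      have hne : oddExponent (j :: J) ≠ 0 := by
        intro h
        rw [h, Finsupp.zero_apply] at hlast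
        omega
      simp [altMonomial_nil, coeff_one, hne.symm]
    | cons i I =>
      have hi : 0 < i := hI i List.mem_cons_self
      have hvanish (L : List ℕ) (e : ℕ →₀ ℕ) (he : e (2 * J.length) ≠ 0) :
          coeff e (altMonomial L (2 * J.length)) = 0 := by
        by_contra hne
        exact lt_irrefl _ (lt_of_mem_support_of_supported (altMonomial_mem_supported L _)
          (mem_support_iff.mpr hne) he)
      have hodd : coeff (oddExponent (j :: J))
          (X (2 * J.length + 1) ^ i * altMonomial I (2 * J.length + 1 + 1)) = 0 := by
        rw [X_pow_eq_monomial, coeff_monomial_mul', if_neg]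
        intro hle
        have := hle (2 * J.length + 1)
        rw [Finsupp.single_eq_same, oddExponent_apply_eq_zero _ (by simp; omega)] at this
        omega
      have heven : coeff (oddExponent (j :: J))
          (X (2 * J.length) ^ i * altMonomial I (2 * J.length)) =
            if i :: I = j :: J then 1 else 0 := by
        rw [X_pow_eq_monomial, coeff_monomial_mul', one_mul]
        rcases lt_trichotomy i j with hij | rfl | hij
        · rw [if_neg (c := i :: I = j :: J) (by simp [hij.ne]), hvanish, ite_self]
          rw [Finsupp.tsub_apply, hlast, Finsupp.single_eq_same]
          omega
        · rw [oddExponent, if_pos (by simp), add_tsub_cancel_right,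
            ih (fun k hk => hJ k (List.mem_cons_of_mem _ hk))
              (fun k hk => hI k (List.mem_cons_of_mem _ hk))]
          simp
        · rw [if_neg, if_neg (by simp [hij.ne'])]
          intro hle
          have := hle (2 * J.length)
          rw [Finsupp.single_eq_same, hlast] at this
          omega
      have hpar : ¬ Even (2 * J.length + 1) := by grind
      rw [List.length_cons, mul_add, mul_one, ← one_add_one_eq_two, ← add_assoc,
        one_add_one_eq_two, altMonomial_cons_succ, altMonomial_cons_succ, if_neg hpar,
        if_pos (even_two_mul _), coeff_add, coeff_add, coeff_neg, hodd, heven,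
        hvanish _ _ (by omega)]
      simp

/-- The solution attached to a composition. -/
noncomputable def compositionSol {d : ℕ} (c : Composition d) : SolHomog d :=
  ⟨altMonomial c.blocks, by
    have h := altMonomial_mem_solHomog (I := c.blocks) fun _ => c.blocks_pos
    rwa [c.blocks_sum] at h⟩

lemma linearIndependent_compositionSol (d : ℕ) :
    LinearIndependent ℂ (compositionSol : Composition d → SolHomog d) := by
  rw [Fintype.linearIndependent_iff]
  intro g hg c
  have h : coeff (oddExponent c.blocks)
      ((∑ b, g b • compositionSol b : SolHomog d).1 (2 * c.blocks.length)) = 0 := by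
    rw [hg]
    simp
  simpa [Finset.sum_apply, coeff_sum, compositionSol, ← Composition.ext_iff,
    coeff_oddExponent_altMonomial (fun _ => c.blocks_pos)
      (fun _ => Composition.blocks_pos _)] using h

/-- For every `n ≥ 1`, the homogeneous degree-`n` component of the space of
solutions of the functional equation is a `ℂ`-vector space of dimension exactly `2 ^ (n-1)`. -/
theorem homogeneous_sol_dimension (n : ℕ) (hn : 1 ≤ n) :
    Module.finrank ℂ (SolHomog n) = 2 ^ (n - 1) := by
  have : Module.Finite ℂ (SolHomog n) :=
    Module.Finite.of_injective _ (compositionCoeff_injective n)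
  rw [← composition_card]
  refine le_antisymm ?_ (linearIndependent_compositionSol n).fintype_card_le_finrank
  simpa using LinearMap.finrank_le_finrank_of_injective (compositionCoeff_injective n)
end

section
/- Let f ∈ Sol. Then f vanishes on every list of interlacing coordinates (i.e. f_{2m+1}(x_1,…,x_{2m+1}) = 0 for every strictly decreasing integer sequence of odd length with zero alternating sum) if and only if there exists a stable polynomial g such that f_n = (Σ_{i=1}^n (−1)^i x_i)·g_n for all n. In other words, the kernel of the evaluation map ActY from Sol to functions on Young diagrams is the ideal generated by M_1(𝕏). -/
open MvPolynomial

/-- The stable polynomial `M_1(𝕏)`, whose `n`-th component is `∑_{i=1}^n (-1)^i x_i`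
(0-based: `∑_{j<n} (-1)^{j+1} x_{j+1}`). -/
noncomputable def M1X : PolySeq := fun n => ∑ i ∈ Finset.range n, ((-1 : ℂ)) ^ (i + 1) • X i

/-- Factors of a polynomial in the variables `s` by one in the variables `s` can be chosen in the
variables `s`. -/
lemma exists_mem_supported_of_dvd {s : Set ℕ} {p q : MvPolynomial ℕ ℂ}
    (hp : p ∈ supported ℂ s) (hq : q ∈ supported ℂ s) (h : q ∣ p) :
    ∃ r ∈ supported ℂ s, p = q * r := by
  rw [supported_eq_range_rename] at hp hq
  obtain ⟨p, rfl⟩ := hp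
  obtain ⟨q, rfl⟩ := hq
  obtain ⟨r, hr⟩ := h
  refine ⟨rename (↑) (killCompl (Subtype.val_injective (p := (· ∈ s))) r), ?_, ?_⟩
  · rw [supported_eq_range_rename]
    exact ⟨_, rfl⟩
  · have := congrArg (killCompl (Subtype.val_injective (p := (· ∈ s)))) hr
    rw [map_mul] at this
    erw [killCompl_rename_app, killCompl_rename_app] at this
    rw [this, map_mul]
    rfl

lemma killVar_mem_supported {n : ℕ} {p : MvPolynomial ℕ ℂ}
    (hp : p ∈ supported ℂ (Set.Iio (n + 1))) : killVar n p ∈ supported ℂ (Set.Iio n) := by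
  have h : supported ℂ (Set.Iio (n + 1)) ≤ (supported ℂ (Set.Iio n)).comap (killVar n) := by
    refine Algebra.adjoin_le ?_
    rintro _ ⟨j, hj, rfl⟩
    change killVar n (X j) ∈ supported ℂ (Set.Iio n)
    rw [killVar, aeval_X]
    split_ifs with hjn
    · exact zero_mem _
    · exact X_mem_supported.2 (by simp only [Set.mem_Iio] at hj ⊢; omega)
  exact h hp

lemma M1X_mem_supported (n : ℕ) : M1X n ∈ supported ℂ (Set.Iio n) :=
  sum_mem fun _ hi =>
    Subalgebra.smul_mem _ (X_mem_supported.2 (Set.mem_Iio.2 (Finset.mem_range.1 hi))) _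

lemma killVar_M1X (n : ℕ) : killVar n (M1X (n + 1)) = M1X n := by
  rw [M1X, M1X, Finset.sum_range_succ, map_add, map_sum]
  simp only [map_smul, killVar, aeval_X, if_true, smul_zero, add_zero]
  exact Finset.sum_congr rfl fun i hi => by rw [if_neg (Finset.mem_range.1 hi).ne]

lemma aeval_M1X (n : ℕ) (x : ℕ → ℂ) :
    aeval x (M1X n) = -∑ j ∈ Finset.range n, (-1) ^ j * x j := by
  simp [M1X, pow_succ]

lemma M1X_succ_ne_zero (n : ℕ) : M1X (n + 1) ≠ 0 := by
  intro h
  have := aeval_M1X (n + 1) (Pi.single 0 1)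
  rw [h, Finset.sum_range_succ'] at this
  simp at this

/-- A polynomial vanishing on the hyperplane `M_1 = 0` is divisible by `M_1`. -/
lemma M1X_dvd_of_aeval_eq_zero {n : ℕ} {p : MvPolynomial ℕ ℂ}
    (h : ∀ x : ℕ → ℂ, ∑ j ∈ Finset.range (n + 1), (-1) ^ j * x j = 0 → aeval x p = 0) :
    M1X (n + 1) ∣ p := by
  set L := M1X (n + 1) with hL
  let φ : MvPolynomial ℕ ℂ →ₐ[ℂ] MvPolynomial ℕ ℂ :=
    aeval fun j => if j = 0 then X 0 + L else X j
  have hφ : φ p = 0 := by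
    refine MvPolynomial.funext fun x => ?_
    have hcomp : eval x (φ p) = aeval (fun j => if j = 0 then x 0 + aeval x L else x j) p := by
      rw [← coe_aeval_eq_eval, RingHom.coe_coe, ← AlgHom.comp_apply]
      congr 1
      ext j
      by_cases hj : j = 0 <;> simp [φ, hj]
    rw [hcomp, map_zero]
    apply h
    rw [hL, aeval_M1X, Finset.sum_range_succ', Finset.sum_range_succ']
    simp
  let I := Ideal.span {L}
  have hmk : (Ideal.Quotient.mkₐ ℂ I).comp φ = Ideal.Quotient.mkₐ ℂ I := by
    ext j
    by_cases hj : j = 0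
    · have : Ideal.Quotient.mk I L = 0 :=
        Ideal.Quotient.eq_zero_iff_mem.2 (Ideal.mem_span_singleton_self L)
      simp [φ, hj, this]
    · simp [φ, hj]
  have hp := DFunLike.congr_fun hmk p
  rw [AlgHom.comp_apply, hφ, map_zero] at hp
  exact Ideal.mem_span_singleton.1 (Ideal.Quotient.eq_zero_iff_mem.1 hp.symm)

lemma sum_range_two_mul_add_one_alternating {R : Type*} [CommRing R] (m : ℕ) (x : ℕ → R) :
    ∑ j ∈ Finset.range (2 * m + 1), (-1) ^ j * x j =
      x 0 - ∑ i ∈ Finset.range m, (x (2 * i + 1) - x (2 * i + 2)) := by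
  induction m with
  | zero => simp
  | succ m ih =>
    rw [show 2 * (m + 1) + 1 = 2 * m + 1 + 1 + 1 by ring, Finset.sum_range_succ,
      Finset.sum_range_succ, ih, Finset.sum_range_succ]
    simp only [pow_succ, pow_mul]
    simp
    ring

/-- The strictly decreasing integer sequences of length `2m+1` with zero alternating sum are
Zariski dense in the hyperplane of sequences with zero alternating sum. -/
lemma aeval_eq_zero_of_interlacing {m : ℕ} {p : MvPolynomial ℕ ℂ}
    (h : ∀ x : ℕ → ℤ, (∀ i, i + 1 ≤ 2 * m → x (i + 1) < x i) →
      (∑ j ∈ Finset.range (2 * m + 1), (-1 : ℤ) ^ j * x j) = 0 →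
      aeval (fun j => ((x j : ℤ) : ℂ)) p = 0)
    (x : ℕ → ℂ) (hx : ∑ j ∈ Finset.range (2 * m + 1), (-1) ^ j * x j = 0) :
    aeval x p = 0 := by
  let φ : MvPolynomial ℕ ℂ →ₐ[ℂ] MvPolynomial ℕ ℂ :=
    aeval fun j => ∑ i ∈ Finset.range m, X (2 * i + 1) - ∑ k ∈ Finset.range j, X k
  have hcomp (y : ℕ → ℂ) : eval y (φ p) = aeval (fun j =>
      ∑ i ∈ Finset.range m, y (2 * i + 1) - ∑ k ∈ Finset.range j, y k) p := by
    rw [← coe_aeval_eq_eval, RingHom.coe_coe, ← AlgHom.comp_apply]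
    congr 1
    ext j
    simp [φ]
  have hφ : φ p = 0 := by
    refine MvPolynomial.funext_set (fun _ => Set.range fun k : ℕ => ((k : ℂ) + 1))
      (fun _ => Set.infinite_range_of_injective fun a b hab => by simpa using hab) fun y hy => ?_
    choose k hk using fun j => hy j (Set.mem_univ j)
    rw [hcomp, map_zero]
    convert h (fun j => ∑ i ∈ Finset.range m, ((k (2 * i + 1) : ℤ) + 1) -
      ∑ i ∈ Finset.range j, ((k i : ℤ) + 1)) ?_ ?_ using 3
    · simp [← hk]
    · intro i _
      simp only [Finset.sum_range_succ]
      linarith [Int.natCast_nonneg (k i)]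
    · rw [sum_range_two_mul_add_one_alternating]
      simp [Finset.sum_range_succ]
  have h0 := hcomp fun j => x j - x (j + 1)
  rw [hφ, map_zero] at h0
  rw [h0]
  rw [sum_range_two_mul_add_one_alternating, sub_eq_zero] at hx
  congr 2
  funext j
  rw [← hx, Finset.sum_range_sub']
  ring

/-- An element of `Sol` vanishes on every list of interlacing coordinates of a
Young diagram (strictly decreasing integer sequences of odd length with vanishing alternating
sum) if and only if it belongs to the ideal generated by `M_1(𝕏)`. -/
theorem ker_actY_eq_ideal_M1 (f : PolySeq) (hf : IsSol f) :
    (∀ (m : ℕ) (x : ℕ → ℤ), (∀ i, i + 1 ≤ 2 * m → x (i + 1) < x i) →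
      (∑ j ∈ Finset.range (2 * m + 1), (-1 : ℤ) ^ j * x j) = 0 →
      aeval (fun j => ((x j : ℤ) : ℂ)) (f (2 * m + 1)) = 0)
    ↔ ∃ g : PolySeq, IsStable g ∧ ∀ n, f n = M1X n * g n := by
  constructor
  · intro h
    have hdvd (n : ℕ) : M1X n ∣ f n := by
      have hodd (m : ℕ) : M1X (2 * m + 1) ∣ f (2 * m + 1) :=
        M1X_dvd_of_aeval_eq_zero (aeval_eq_zero_of_interlacing (h m))
      rcases Nat.even_or_odd' n with ⟨m, rfl | rfl⟩
      · rw [← killVar_M1X, ← hf.1.2]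
        exact map_dvd _ (hodd m)
      · exact hodd m
    choose r hr hfr using fun n =>
      exists_mem_supported_of_dvd (hf.1.1 n) (M1X_mem_supported n) (hdvd n)
    have hg (n : ℕ) : f n = M1X n * killVar n (r (n + 1)) := by
      rw [← hf.1.2 n, hfr (n + 1), map_mul, killVar_M1X]
    refine ⟨fun n => killVar n (r (n + 1)), ⟨fun n => killVar_mem_supported (hr _), fun n => ?_⟩,
      hg⟩
    exact congrArg (killVar n)
      (mul_left_cancel₀ (M1X_succ_ne_zero n) ((hg (n + 1)).symm.trans (hfr (n + 1))))
  · rintro ⟨g, -, hg⟩ m x - hx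
    have hx' : ∑ j ∈ Finset.range (2 * m + 1), (-1 : ℂ) ^ j * (x j : ℂ) = 0 := by
      exact_mod_cast congrArg (Int.cast : ℤ → ℂ) hx
    rw [hg, map_mul, aeval_M1X, hx', neg_zero, zero_mul]
end

section
/- The substitution map Φ_{x→p,q} sends Sol into Sol′, the substitution map Φ_{p,q→x} sends Sol′ into Sol, and Φ_{x→p,q} ∘ Φ_{p,q→x} = Id on Sol′. In particular Φ_{x→p,q}: Sol → Sol′ is surjective. -/
open MvPolynomial

/-- Polynomials in the two families of (commuting) variables `p_1, p_2, …` (`Sum.inl`, 0-based)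
and `q_1, q_2, …` (`Sum.inr`, 0-based). -/
abbrev PQPoly : Type := MvPolynomial (ℕ ⊕ ℕ) ℂ

/-- Sequences of polynomials, the `m`-th term being thought of as a polynomial in
`p_1, …, p_m, q_1, …, q_m`. -/
abbrev PQSeq : Type := (m : ℕ) → PQPoly

/-- The variables `p_1, …, p_m, q_1, …, q_m`. -/
def pqVars (m : ℕ) : Set (ℕ ⊕ ℕ) := Sum.inl '' Set.Iio m ∪ Sum.inr '' Set.Iio m

/-- Substituting `0` for both `p_{m+1}` and `q_{m+1}` (0-based index `m`). -/
noncomputable def killPQ (m : ℕ) : PQPoly →ₐ[ℂ] PQPoly :=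
  aeval (Sum.elim (fun k => if k = m then 0 else X (Sum.inl k))
    (fun k => if k = m then 0 else X (Sum.inr k)))

/-- `h` is a two-alphabet stable polynomial. -/
def IsStablePQ (h : PQSeq) : Prop :=
  (∀ m, h m ∈ supported ℂ (pqVars m)) ∧ ∀ m, killPQ m (h (m + 1)) = h m

/-- Substituting `0` for the variable `v0`. -/
noncomputable def subst0PQ (v0 : ℕ ⊕ ℕ) : PQPoly →ₐ[ℂ] PQPoly :=
  aeval (fun v => if v = v0 then 0 else X v)

/-- The substitution describing the right-hand side of equation (EqQZero) : the parts
`p_{j+1}` and `p_{j+2}` are merged (`0`-based : `p_j`, `p_{j+1}`) and `q_{j+1}` is removed. -/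
noncomputable def mergeP (j : ℕ) : PQPoly →ₐ[ℂ] PQPoly :=
  aeval (Sum.elim
    (fun k => if k < j then X (Sum.inl k)
      else if k = j then X (Sum.inl j) + X (Sum.inl (j + 1)) else X (Sum.inl (k + 1)))
    (fun k => if k < j then X (Sum.inr k) else X (Sum.inr (k + 1))))

/-- The substitution describing the right-hand side of equation (EqPZero) : `p_{j+1}`
(0-based `p_j`, `1 ≤ j`) is removed and the parts `q_{j-1}`, `q_j` (0-based) are merged. -/
noncomputable def mergeQ (j : ℕ) : PQPoly →ₐ[ℂ] PQPoly :=
  aeval (Sum.elim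
    (fun k => if k < j then X (Sum.inl k) else X (Sum.inl (k + 1)))
    (fun k => if k + 1 < j then X (Sum.inr k)
      else if k + 1 = j then X (Sum.inr k) + X (Sum.inr (k + 1)) else X (Sum.inr (k + 1))))

/-- The shift substitution, for the case `p_1 = 0` of equation (EqPZero). -/
noncomputable def shiftPQ : PQPoly →ₐ[ℂ] PQPoly :=
  aeval (Sum.elim (fun k => X (Sum.inl (k + 1))) (fun k => X (Sum.inr (k + 1))))

/-- The system of equations (EqQZero)-(EqPZero) defining `Sol'`: a two alphabet stable
polynomial whose components take the same values on any two multirectangular descriptions of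
a Young diagram. -/
def IsSolPQ (h : PQSeq) : Prop :=
  IsStablePQ h ∧
  (∀ m j, j + 2 ≤ m → subst0PQ (Sum.inr j) (h m) = mergeP j (h (m - 1))) ∧
  (∀ m, 1 ≤ m → subst0PQ (Sum.inr (m - 1)) (h m) = h (m - 1)) ∧
  (∀ m j, 1 ≤ j → j + 1 ≤ m → subst0PQ (Sum.inl j) (h m) = mergeQ j (h (m - 1))) ∧
  (∀ m, 1 ≤ m → subst0PQ (Sum.inl 0) (h m) = shiftPQ (h (m - 1)))

/-- The polynomial expression of the interlacing coordinate `x_{t+1}` (0-based index `t`)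
in terms of multirectangular coordinates:
`x_{2i+1} = (q_{i+1} + … + q_m) - (p_1 + … + p_i)` and
`x_{2i} = (q_i + … + q_m) - (p_1 + … + p_i)`. -/
noncomputable def xExpr (m t : ℕ) : PQPoly :=
  (∑ k ∈ Finset.Ico (if t % 2 = 0 then (t + 1) / 2 else (t + 1) / 2 - 1) m, X (Sum.inr k))
    - ∑ k ∈ Finset.range ((t + 1) / 2), X (Sum.inl k)

/-- The change of variables `Φ_{x → p,q}` from interlacing to multirectangular coordinates. -/
noncomputable def PhiXtoPQ (f : PolySeq) : PQSeq :=
  fun m => aeval (xExpr m) (f (2 * m + 1))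

/-- The multirectangular coordinates in terms of interlacing coordinates:
`p_i = x_{2i-1} - x_{2i}` and `q_i = x_{2i} - x_{2i+1}` (all 0-based here). -/
noncomputable def pqExpr : (ℕ ⊕ ℕ) → MvPolynomial ℕ ℂ :=
  Sum.elim (fun k => X (2 * k) - X (2 * k + 1)) (fun k => X (2 * k + 1) - X (2 * k + 2))

/-- The change of variables `Φ_{p,q → x}` from multirectangular to interlacing coordinates. -/
noncomputable def PhiPQtoX (h : PQSeq) : PolySeq :=
  fun n => if n % 2 = 1 then aeval pqExpr (h (n / 2))
    else killVar n (aeval pqExpr (h (n / 2)))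

/-- Two algebra morphisms agreeing on the variables in `s` agree on polynomials supported in `s`. -/
lemma algHom_congr_of_mem_supported {σ A : Type*} [CommRing A] [Algebra ℂ A] {s : Set σ}
    {φ ψ : MvPolynomial σ ℂ →ₐ[ℂ] A} {p : MvPolynomial σ ℂ} (hp : p ∈ supported ℂ s)
    (h : ∀ i ∈ s, φ (X i) = ψ (X i)) : φ p = ψ p := by
  rw [supported_eq_adjoin_X] at hp
  refine (AlgHom.eqOn_adjoin_iff (φ := φ) (ψ := ψ)).2 ?_ hp
  rintro _ ⟨i, hi, rfl⟩
  exact h i hi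

lemma algHom_mem_supported {σ τ : Type*} {s : Set σ} {t : Set τ}
    {φ : MvPolynomial σ ℂ →ₐ[ℂ] MvPolynomial τ ℂ} {p : MvPolynomial σ ℂ} (hp : p ∈ supported ℂ s)
    (h : ∀ i ∈ s, φ (X i) ∈ supported ℂ t) : φ p ∈ supported ℂ t := by
  rw [supported_eq_adjoin_X] at hp
  have hle : Algebra.adjoin ℂ (X '' s) ≤ (supported ℂ t).comap φ := by
    refine Algebra.adjoin_le ?_
    rintro _ ⟨i, hi, rfl⟩
    exact h i hi
  exact hle hp

lemma forall_mem_pqVars {m : ℕ} {P : ℕ ⊕ ℕ → Prop} (hl : ∀ k < m, P (Sum.inl k))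
    (hr : ∀ k < m, P (Sum.inr k)) : ∀ v ∈ pqVars m, P v := by
  rintro _ (⟨k, hk, rfl⟩ | ⟨k, hk, rfl⟩)
  · exact hl k hk
  · exact hr k hk

/-- The partial sum `p_1 + … + p_i`. -/
noncomputable def pSum (i : ℕ) : PQPoly := ∑ k ∈ Finset.range i, X (Sum.inl k)

/-- The partial sum `q_1 + … + q_i`. -/
noncomputable def qSum (i : ℕ) : PQPoly := ∑ k ∈ Finset.range i, X (Sum.inr k)

lemma pSum_succ (i : ℕ) : pSum (i + 1) = pSum i + X (Sum.inl i) := Finset.sum_range_succ _ _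

lemma qSum_succ (i : ℕ) : qSum (i + 1) = qSum i + X (Sum.inr i) := Finset.sum_range_succ _ _

lemma pSum_zero : pSum 0 = 0 := Finset.sum_range_zero _

lemma qSum_zero : qSum 0 = 0 := Finset.sum_range_zero _

lemma xExpr_even {m i : ℕ} (h : i ≤ m) : xExpr m (2 * i) = qSum m - qSum i - pSum i := by
  have h1 : (2 * i + 1) / 2 = i := by omega
  simp only [xExpr, h1, Nat.mul_mod_right, if_true, Finset.sum_Ico_eq_sub _ h, pSum, qSum]

lemma xExpr_odd {m i : ℕ} (h : i ≤ m) :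
    xExpr m (2 * i + 1) = qSum m - qSum i - pSum (i + 1) := by
  have h1 : (2 * i + 1 + 1) / 2 = i + 1 := by omega
  have h2 : ¬ (2 * i + 1) % 2 = 0 := by omega
  simp only [xExpr, h1, h2, if_false, Nat.add_sub_cancel, Finset.sum_Ico_eq_sub _ h, pSum, qSum]

lemma pSum_mem_supported {m i : ℕ} (h : i ≤ m) : pSum i ∈ supported ℂ (pqVars m) :=
  Subalgebra.sum_mem _ fun k hk => X_mem_supported.2
    (Or.inl ⟨k, (Finset.mem_range.1 hk).trans_le h, rfl⟩)

lemma qSum_mem_supported {m i : ℕ} (h : i ≤ m) : qSum i ∈ supported ℂ (pqVars m) :=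
  Subalgebra.sum_mem _ fun k hk => X_mem_supported.2
    (Or.inr ⟨k, (Finset.mem_range.1 hk).trans_le h, rfl⟩)

lemma xExpr_mem_supported {m t : ℕ} (h : t < 2 * m + 1) : xExpr m t ∈ supported ℂ (pqVars m) := by
  obtain ⟨i, rfl | rfl⟩ := t.even_or_odd'
  · rw [xExpr_even (by omega)]
    exact sub_mem (sub_mem (qSum_mem_supported le_rfl) (qSum_mem_supported (by omega)))
      (pSum_mem_supported (by omega))
  · rw [xExpr_odd (by omega)]
    exact sub_mem (sub_mem (qSum_mem_supported le_rfl) (qSum_mem_supported (by omega)))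
      (pSum_mem_supported (by omega))

/-- A substitution of the `p, q` identifying two consecutive interlacing coordinates relates
consecutive terms of `PhiXtoPQ f`. -/
lemma IsSol.algHom_PhiXtoPQ_succ {f : PolySeq} (hf : IsSol f) {m j : ℕ} (hj : j < 2 * m + 2)
    {σ τ : PQPoly →ₐ[ℂ] PQPoly} (heq : σ (xExpr (m + 1) j) = σ (xExpr (m + 1) (j + 1)))
    (hskip : ∀ t < 2 * m + 1,
      σ (xExpr (m + 1) (if t < j then t else t + 2)) = τ (xExpr m t)) :
    σ (PhiXtoPQ f (m + 1)) = τ (PhiXtoPQ f m) := by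
  have hcol : (σ.comp (aeval (xExpr (m + 1)))).comp (collapse j)
      = σ.comp (aeval (xExpr (m + 1))) := by
    ext k : 1
    by_cases hk : k = j + 1
    · simp [collapse, hk, heq]
    · simp [collapse, hk]
  calc σ (PhiXtoPQ f (m + 1))
      = ((σ.comp (aeval (xExpr (m + 1)))).comp (collapse j)) (f (2 * (m + 1) + 1)) := by
        rw [hcol]; rfl
    _ = (σ.comp (aeval (xExpr (m + 1)))) (collapse j (f (2 * (m + 1) + 1))) := rfl
    _ = ((σ.comp (aeval (xExpr (m + 1)))).comp (skip2 j)) (f (2 * m + 1)) := by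
        rw [hf.2 _ j (by omega)]; rfl
    _ = (τ.comp (aeval (xExpr m))) (f (2 * m + 1)) := by
        refine algHom_congr_of_mem_supported (hf.1.1 _) fun t ht => ?_
        simpa [skip2] using hskip t ht
    _ = τ (PhiXtoPQ f m) := rfl

/-- A version of `IsSol.algHom_PhiXtoPQ_succ` for substitutions making `p_{j+1}` vanish. -/
lemma IsSol.algHom_PhiXtoPQ_of_inl {f : PolySeq} (hf : IsSol f) {m j : ℕ} (hj : j ≤ m)
    {σ τ : PQPoly →ₐ[ℂ] PQPoly} (h0 : σ (X (Sum.inl j)) = 0)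
    (hp : ∀ i ≤ j, σ (pSum i) = τ (pSum i)) (hp' : ∀ i ≥ j, σ (pSum (i + 1)) = τ (pSum i))
    (c : PQPoly)
    (hq : ∀ i < j, σ (qSum i) = c + τ (qSum i))
    (hq' : ∀ i ≥ j, σ (qSum (i + 1)) = c + τ (qSum i)) :
    σ (PhiXtoPQ f (m + 1)) = τ (PhiXtoPQ f m) := by
  refine hf.algHom_PhiXtoPQ_succ (j := 2 * j) (by omega) ?_ fun t ht => ?_
  · rw [xExpr_even (by omega), xExpr_odd (by omega), pSum_succ]
    simp [h0]
  · obtain ⟨i, rfl | rfl⟩ := t.even_or_odd'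
    · split_ifs with h
      · rw [xExpr_even (by omega), xExpr_even (by omega)]
        simp only [map_sub, hq' m hj, hq i (by omega), hp i (by omega)]
        ring
      · rw [show 2 * i + 2 = 2 * (i + 1) by ring, xExpr_even (by omega), xExpr_even (by omega)]
        simp only [map_sub, hq' m hj, hq' i (by omega), hp' i (by omega)]
        ring
    · split_ifs with h
      · rw [xExpr_odd (by omega), xExpr_odd (by omega)]
        simp only [map_sub, hq' m hj, hq i (by omega), hp (i + 1) (by omega)]
        ring
      · rw [show 2 * i + 1 + 2 = 2 * (i + 1) + 1 by ring, xExpr_odd (by omega),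
          xExpr_odd (by omega)]
        simp only [map_sub, hq' m hj, hq' i (by omega), hp' (i + 1) (by omega)]
        ring

/-- A version of `IsSol.algHom_PhiXtoPQ_succ` for substitutions making `q_{j+1}` vanish. -/
lemma IsSol.algHom_PhiXtoPQ_of_inr {f : PolySeq} (hf : IsSol f) {m j : ℕ} (hj : j ≤ m)
    {σ τ : PQPoly →ₐ[ℂ] PQPoly} (h0 : σ (X (Sum.inr j)) = 0)
    (hp : ∀ i ≤ j, σ (pSum i) = τ (pSum i))
    (hp' : ∀ i > j, i ≤ m → σ (pSum (i + 1)) = τ (pSum i))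
    (hq : ∀ i ≤ j, σ (qSum i) = τ (qSum i))
    (hq' : ∀ i ≥ j, i ≤ m → σ (qSum (i + 1)) = τ (qSum i)) :
    σ (PhiXtoPQ f (m + 1)) = τ (PhiXtoPQ f m) := by
  refine hf.algHom_PhiXtoPQ_succ (j := 2 * j + 1) (by omega) ?_ fun t ht => ?_
  · rw [show 2 * j + 1 + 1 = 2 * (j + 1) by ring, xExpr_even (by omega), xExpr_odd (by omega),
      qSum_succ j]
    simp [h0]
  · obtain ⟨i, rfl | rfl⟩ := t.even_or_odd'
    · split_ifs with h
      · rw [xExpr_even (by omega), xExpr_even (by omega)]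
        simp only [map_sub, hq' m hj le_rfl, hq i (by omega), hp i (by omega)]
      · rw [show 2 * i + 2 = 2 * (i + 1) by ring, xExpr_even (by omega), xExpr_even (by omega)]
        simp only [map_sub, hq' m hj le_rfl, hq' i (by omega) (by omega),
          hp' i (by omega) (by omega)]
    · split_ifs with h
      · rw [xExpr_odd (by omega), xExpr_odd (by omega)]
        simp only [map_sub, hq' m hj le_rfl, hq i (by omega), hp (i + 1) (by omega)]
      · rw [show 2 * i + 1 + 2 = 2 * (i + 1) + 1 by ring, xExpr_odd (by omega),
          xExpr_odd (by omega)]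
        simp only [map_sub, hq' m hj le_rfl, hq' i (by omega) (by omega),
          hp' (i + 1) (by omega) (by omega)]

lemma algHom_pSum_congr {σ τ : PQPoly →ₐ[ℂ] PQPoly} {n : ℕ}
    (h : ∀ k < n, σ (X (Sum.inl k)) = τ (X (Sum.inl k))) {i : ℕ} (hi : i ≤ n) :
    σ (pSum i) = τ (pSum i) := by
  simp only [pSum, map_sum]
  exact Finset.sum_congr rfl fun k hk => h k ((Finset.mem_range.1 hk).trans_le hi)

lemma algHom_qSum_congr {σ τ : PQPoly →ₐ[ℂ] PQPoly} {n : ℕ}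
    (h : ∀ k < n, σ (X (Sum.inr k)) = τ (X (Sum.inr k))) {i : ℕ} (hi : i ≤ n) :
    σ (qSum i) = τ (qSum i) := by
  simp only [qSum, map_sum]
  exact Finset.sum_congr rfl fun k hk => h k ((Finset.mem_range.1 hk).trans_le hi)

lemma algHom_pSum_succ_of_le {σ τ : PQPoly →ₐ[ℂ] PQPoly} {n : ℕ} {c : PQPoly}
    (h0 : σ (pSum (n + 1)) = c + τ (pSum n))
    (h : ∀ k ≥ n, σ (X (Sum.inl (k + 1))) = τ (X (Sum.inl k))) {i : ℕ} (hi : n ≤ i) :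
    σ (pSum (i + 1)) = c + τ (pSum i) := by
  induction i, hi using Nat.le_induction with
  | base => exact h0
  | succ k hk ih => rw [pSum_succ, map_add, ih, h k hk, pSum_succ k, map_add, add_assoc]

lemma algHom_qSum_succ_of_le {σ τ : PQPoly →ₐ[ℂ] PQPoly} {n : ℕ} {c : PQPoly}
    (h0 : σ (qSum (n + 1)) = c + τ (qSum n))
    (h : ∀ k ≥ n, σ (X (Sum.inr (k + 1))) = τ (X (Sum.inr k))) {i : ℕ} (hi : n ≤ i) :
    σ (qSum (i + 1)) = c + τ (qSum i) := by
  induction i, hi using Nat.le_induction with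
  | base => exact h0
  | succ k hk ih => rw [qSum_succ, map_add, ih, h k hk, qSum_succ k, map_add, add_assoc]

lemma IsSol.killPQ_PhiXtoPQ {f : PolySeq} (hf : IsSol f) (m : ℕ) :
    killPQ m (PhiXtoPQ f (m + 1)) = PhiXtoPQ f m := by
  have hp : ∀ i ≤ m, killPQ m (pSum i) = AlgHom.id ℂ _ (pSum i) := fun i hi =>
    algHom_pSum_congr (fun k hk => by simp [killPQ, hk.ne]) hi
  have hq : ∀ i ≤ m, killPQ m (qSum i) = AlgHom.id ℂ _ (qSum i) := fun i hi =>
    algHom_qSum_congr (fun k hk => by simp [killPQ, hk.ne]) hi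
  refine hf.algHom_PhiXtoPQ_of_inr (τ := AlgHom.id ℂ _) le_rfl (by simp [killPQ]) hp
    (fun i h1 h2 => absurd h1 h2.not_gt) hq fun i h1 h2 => ?_
  obtain rfl := le_antisymm h2 h1
  rw [qSum_succ, map_add, hq _ le_rfl]
  simp [killPQ]

lemma IsSol.subst0PQ_inr_PhiXtoPQ {f : PolySeq} (hf : IsSol f) {m j : ℕ} (hj : j < m) :
    subst0PQ (Sum.inr j) (PhiXtoPQ f (m + 1)) = mergeP j (PhiXtoPQ f m) := by
  have hp : ∀ i ≤ j, subst0PQ (Sum.inr j) (pSum i) = mergeP j (pSum i) := fun i hi =>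
    algHom_pSum_congr (fun k hk => by simp [subst0PQ, mergeP, hk]) hi
  have hq : ∀ i ≤ j, subst0PQ (Sum.inr j) (qSum i) = mergeP j (qSum i) := fun i hi =>
    algHom_qSum_congr (fun k hk => by simp [subst0PQ, mergeP, hk, hk.ne]) hi
  refine hf.algHom_PhiXtoPQ_of_inr hj.le (by simp [subst0PQ]) hp (fun i hi _ => ?_) hq
    fun i hi _ => ?_
  · rw [← zero_add (mergeP j _)]
    refine algHom_pSum_succ_of_le ?_ (fun k hk => ?_) (Nat.succ_le_of_lt hi)
    · rw [Nat.succ_eq_add_one, pSum_succ, pSum_succ, map_add, map_add, map_add, hp j le_rfl]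
      simp [subst0PQ, mergeP, add_assoc]
    · simp [subst0PQ, mergeP, show ¬ k < j by omega, show ¬ k = j by omega]
  · rw [← zero_add (mergeP j _)]
    refine algHom_qSum_succ_of_le ?_ (fun k hk => ?_) hi
    · rw [qSum_succ, map_add, hq j le_rfl]
      simp [subst0PQ]
    · simp [subst0PQ, mergeP, show ¬ k < j by omega, show ¬ k + 1 = j by omega]

lemma IsSol.subst0PQ_inr_last_PhiXtoPQ {f : PolySeq} (hf : IsSol f) (m : ℕ) :
    subst0PQ (Sum.inr m) (PhiXtoPQ f (m + 1)) = PhiXtoPQ f m := by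
  have hp : ∀ i ≤ m, subst0PQ (Sum.inr m) (pSum i) = AlgHom.id ℂ _ (pSum i) := fun i hi =>
    algHom_pSum_congr (fun k hk => by simp [subst0PQ]) hi
  have hq : ∀ i ≤ m, subst0PQ (Sum.inr m) (qSum i) = AlgHom.id ℂ _ (qSum i) := fun i hi =>
    algHom_qSum_congr (fun k hk => by simp [subst0PQ, hk.ne]) hi
  refine hf.algHom_PhiXtoPQ_of_inr (τ := AlgHom.id ℂ _) le_rfl (by simp [subst0PQ]) hp
    (fun i h1 h2 => absurd h1 h2.not_gt) hq fun i h1 h2 => ?_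
  obtain rfl := le_antisymm h2 h1
  rw [qSum_succ, map_add, hq _ le_rfl]
  simp [subst0PQ]

lemma IsSol.subst0PQ_inl_PhiXtoPQ {f : PolySeq} (hf : IsSol f) {m j : ℕ} (hj : j + 1 ≤ m) :
    subst0PQ (Sum.inl (j + 1)) (PhiXtoPQ f (m + 1)) = mergeQ (j + 1) (PhiXtoPQ f m) := by
  have hp : ∀ i ≤ j + 1, subst0PQ (Sum.inl (j + 1)) (pSum i) = mergeQ (j + 1) (pSum i) :=
    fun i hi => algHom_pSum_congr (fun k hk => by simp [subst0PQ, mergeQ, hk.ne, Nat.le_of_lt_succ hk]) hi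
  have hq : ∀ i ≤ j, subst0PQ (Sum.inl (j + 1)) (qSum i) = mergeQ (j + 1) (qSum i) :=
    fun i hi => algHom_qSum_congr (fun k hk => by simp [subst0PQ, mergeQ, hk]) hi
  refine hf.algHom_PhiXtoPQ_of_inl hj (by simp [subst0PQ]) hp (fun i hi => ?_) 0
    (fun i hi => by rw [zero_add, hq i (by omega)]) fun i hi => ?_
  · rw [← zero_add (mergeQ _ _)]
    refine algHom_pSum_succ_of_le ?_ (fun k hk => ?_) hi
    · rw [pSum_succ, map_add, hp _ le_rfl]
      simp [subst0PQ]
    · simp [subst0PQ, mergeQ, show j < k by omega, show ¬ k = j by omega]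
  · refine algHom_qSum_succ_of_le ?_ (fun k hk => ?_) hi
    · rw [qSum_succ, qSum_succ, map_add, map_add, map_add, hq j le_rfl]
      simp [subst0PQ, mergeQ, add_assoc]
    · simp [subst0PQ, mergeQ, show ¬ k < j by omega, show ¬ k = j by omega]

lemma IsSol.subst0PQ_inl_zero_PhiXtoPQ {f : PolySeq} (hf : IsSol f) (m : ℕ) :
    subst0PQ (Sum.inl 0) (PhiXtoPQ f (m + 1)) = shiftPQ (PhiXtoPQ f m) := by
  refine hf.algHom_PhiXtoPQ_of_inl (Nat.zero_le m) (by simp [subst0PQ]) (fun i hi => ?_)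
    (fun i hi => ?_) (X (Sum.inr 0)) (fun i hi => absurd hi (Nat.not_lt_zero i)) fun i hi => ?_
  · obtain rfl := Nat.le_zero.1 hi
    simp [pSum_zero]
  · rw [← zero_add (shiftPQ _)]
    exact algHom_pSum_succ_of_le (by simp [pSum, subst0PQ])
      (fun k hk => by simp [subst0PQ, shiftPQ]) hi
  · exact algHom_qSum_succ_of_le (by simp [qSum, subst0PQ])
      (fun k hk => by simp [subst0PQ, shiftPQ]) hi

lemma IsSol.isSolPQ_PhiXtoPQ {f : PolySeq} (hf : IsSol f) : IsSolPQ (PhiXtoPQ f) := by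
  refine ⟨⟨fun m => ?_, hf.killPQ_PhiXtoPQ⟩, fun m j h => ?_, fun m h => ?_, fun m j h1 h2 => ?_,
    fun m h => ?_⟩
  · refine algHom_mem_supported (hf.1.1 _) fun t ht => ?_
    rw [aeval_X]
    exact xExpr_mem_supported ht
  · obtain ⟨m, rfl⟩ := Nat.exists_eq_add_of_le' (show 1 ≤ m by omega)
    exact hf.subst0PQ_inr_PhiXtoPQ (by omega)
  · obtain ⟨m, rfl⟩ := Nat.exists_eq_add_of_le' h
    exact hf.subst0PQ_inr_last_PhiXtoPQ m
  · obtain ⟨m, rfl⟩ := Nat.exists_eq_add_of_le' (show 1 ≤ m by omega)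
    obtain ⟨j, rfl⟩ := Nat.exists_eq_add_of_le' h1
    exact hf.subst0PQ_inl_PhiXtoPQ (by omega)
  · obtain ⟨m, rfl⟩ := Nat.exists_eq_add_of_le' h
    exact hf.subst0PQ_inl_zero_PhiXtoPQ m

lemma PhiPQtoX_odd (h : PQSeq) (m : ℕ) : PhiPQtoX h (2 * m + 1) = aeval pqExpr (h m) := by
  have h1 : (2 * m + 1) % 2 = 1 := by omega
  have h2 : (2 * m + 1) / 2 = m := by omega
  simp only [PhiPQtoX, h1, h2, if_true]

lemma PhiPQtoX_even (h : PQSeq) (m : ℕ) :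
    PhiPQtoX h (2 * m) = killVar (2 * m) (PhiPQtoX h (2 * m + 1)) := by
  have h1 : ¬ (2 * m) % 2 = 1 := by omega
  have h2 : (2 * m) / 2 = m := by omega
  rw [PhiPQtoX_odd]
  simp only [PhiPQtoX, h1, h2, if_false]

/-- A morphism vanishing on the expression of a variable does not see that this variable is
set to zero. -/
lemma algHom_aeval_pqExpr_subst0PQ {φ : MvPolynomial ℕ ℂ →ₐ[ℂ] MvPolynomial ℕ ℂ} {v : ℕ ⊕ ℕ}
    (hv : φ (pqExpr v) = 0) (p : PQPoly) :
    φ (aeval pqExpr (subst0PQ v p)) = φ (aeval pqExpr p) := by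
  suffices h : (φ.comp (aeval pqExpr)).comp (subst0PQ v) = φ.comp (aeval pqExpr) from
    DFunLike.congr_fun h p
  ext w : 1
  by_cases hw : w = v
  · simp [subst0PQ, hw, hv]
  · simp [subst0PQ, hw]

lemma IsSolPQ.algHom_aeval_pqExpr_succ {h : PQSeq} (hh : IsSolPQ h) {m : ℕ} {v : ℕ ⊕ ℕ}
    {φ ψ : MvPolynomial ℕ ℂ →ₐ[ℂ] MvPolynomial ℕ ℂ} {τ : PQPoly →ₐ[ℂ] PQPoly}
    (hv : φ (pqExpr v) = 0) (heq : subst0PQ v (h (m + 1)) = τ (h m))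
    (hl : ∀ k < m, φ (aeval pqExpr (τ (X (Sum.inl k)))) = ψ (pqExpr (Sum.inl k)))
    (hr : ∀ k < m, φ (aeval pqExpr (τ (X (Sum.inr k)))) = ψ (pqExpr (Sum.inr k))) :
    φ (aeval pqExpr (h (m + 1))) = ψ (aeval pqExpr (h m)) := by
  rw [← algHom_aeval_pqExpr_subst0PQ hv, heq]
  refine algHom_congr_of_mem_supported (φ := (φ.comp (aeval pqExpr)).comp τ)
    (ψ := ψ.comp (aeval pqExpr)) (hh.1.1 m) (forall_mem_pqVars (fun k hk => ?_) fun k hk => ?_)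
  · simpa using hl k hk
  · simpa using hr k hk

lemma pqExpr_inl (k : ℕ) : pqExpr (Sum.inl k) = X (2 * k) - X (2 * k + 1) := rfl

lemma pqExpr_inr (k : ℕ) : pqExpr (Sum.inr k) = X (2 * k + 1) - X (2 * k + 2) := rfl

lemma collapse_X (j k : ℕ) : collapse j (X k) = X (if k = j + 1 then j else k) := by
  simp only [collapse, aeval_X]
  split_ifs <;> rfl

lemma skip2_X (j k : ℕ) : skip2 j (X k) = X (if k < j then k else k + 2) := by
  simp [skip2]

lemma killVar_X (j k : ℕ) : killVar j (X k) = if k = j then 0 else X k := by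
  simp [killVar]

lemma IsSolPQ.PhiPQtoX_odd_mem_supported {h : PQSeq} (hh : IsSolPQ h) (m : ℕ) :
    PhiPQtoX h (2 * m + 1) ∈ supported ℂ (Set.Iio (2 * m + 1)) := by
  rw [PhiPQtoX_odd]
  refine algHom_mem_supported (hh.1.1 m) (forall_mem_pqVars (fun k hk => ?_) fun k hk => ?_)
  · rw [aeval_X, pqExpr_inl]
    exact sub_mem (X_mem_supported.2 (Set.mem_Iio.2 (by omega)))
      (X_mem_supported.2 (Set.mem_Iio.2 (by omega)))
  · rw [aeval_X, pqExpr_inr]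
    exact sub_mem (X_mem_supported.2 (Set.mem_Iio.2 (by omega)))
      (X_mem_supported.2 (Set.mem_Iio.2 (by omega)))

lemma IsSolPQ.PhiPQtoX_mem_supported {h : PQSeq} (hh : IsSolPQ h) (n : ℕ) :
    PhiPQtoX h n ∈ supported ℂ (Set.Iio n) := by
  obtain ⟨m, rfl | rfl⟩ := n.even_or_odd'
  · rw [PhiPQtoX_even]
    refine algHom_mem_supported (hh.PhiPQtoX_odd_mem_supported m) fun t ht => ?_
    rw [killVar_X]
    split_ifs with h
    · exact zero_mem _
    · exact X_mem_supported.2 (lt_of_le_of_ne (Nat.lt_succ_iff.1 ht) h)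
  · exact hh.PhiPQtoX_odd_mem_supported m

lemma IsSolPQ.killVar_PhiPQtoX {h : PQSeq} (hh : IsSolPQ h) (n : ℕ) :
    killVar n (PhiPQtoX h (n + 1)) = PhiPQtoX h n := by
  obtain ⟨m, rfl | rfl⟩ := n.even_or_odd'
  · exact (PhiPQtoX_even h m).symm
  · rw [show 2 * m + 1 + 1 = 2 * (m + 1) by ring, PhiPQtoX_even, PhiPQtoX_odd, PhiPQtoX_odd]
    change ((killVar (2 * m + 1)).comp (killVar (2 * (m + 1)))) (aeval pqExpr (h (m + 1)))
      = AlgHom.id ℂ _ (aeval pqExpr (h m))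
    refine hh.algHom_aeval_pqExpr_succ
      (v := Sum.inr m) (τ := AlgHom.id ℂ _) ?_
      (hh.2.2.1 (m + 1) (by omega)) (fun k hk => ?_) fun k hk => ?_
    · simp [pqExpr_inr, killVar_X, Nat.mul_add]
    · simp [pqExpr_inl, killVar_X, show k ≠ m + 1 by omega, show 2 * k ≠ 2 * m + 1 by omega,
        show 2 * k + 1 ≠ 2 * (m + 1) by omega, show k ≠ m by omega]
    · simp [pqExpr_inr, killVar_X, show 2 * k + 1 ≠ 2 * (m + 1) by omega,
        show 2 * k + 2 ≠ 2 * (m + 1) by omega, show 2 * k + 2 ≠ 2 * m + 1 by omega,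
        show k ≠ m by omega]

lemma IsSolPQ.collapse_PhiPQtoX_odd {h : PQSeq} (hh : IsSolPQ h) {m j : ℕ} (hj : j ≤ 2 * m + 1) :
    collapse j (PhiPQtoX h (2 * (m + 1) + 1)) = skip2 j (PhiPQtoX h (2 * m + 1)) := by
  rw [PhiPQtoX_odd, PhiPQtoX_odd]
  obtain ⟨i, rfl | rfl⟩ := j.even_or_odd'
  · have hv : collapse (2 * i) (pqExpr (Sum.inl i)) = 0 := by simp [pqExpr_inl, collapse_X]
    obtain rfl | hi := Nat.eq_zero_or_pos i
    · refine hh.algHom_aeval_pqExpr_succ hv (hh.2.2.2.2 (m + 1) (by omega)) (fun k hk => ?_)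
        fun k hk => ?_
      · simp [shiftPQ, pqExpr_inl, collapse_X, skip2_X, Nat.mul_add]
      · simp [shiftPQ, pqExpr_inr, collapse_X, skip2_X, Nat.mul_add]
    · refine hh.algHom_aeval_pqExpr_succ hv (hh.2.2.2.1 (m + 1) i hi (by omega)) (fun k hk => ?_)
        fun k hk => ?_
      · simp only [mergeQ, aeval_X, Sum.elim_inl]
        split_ifs <;> simp only [aeval_X, pqExpr_inl, map_sub, collapse_X, skip2_X] <;>
          grind
      · simp only [mergeQ, aeval_X, Sum.elim_inr]
        split_ifs <;> simp only [aeval_X, pqExpr_inr, map_sub, map_add, collapse_X, skip2_X] <;>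
          grind
  · have hv : collapse (2 * i + 1) (pqExpr (Sum.inr i)) = 0 := by simp [pqExpr_inr, collapse_X]
    obtain rfl | hi := eq_or_lt_of_le (show i ≤ m by omega)
    · refine hh.algHom_aeval_pqExpr_succ (τ := AlgHom.id ℂ _) hv (hh.2.2.1 (i + 1) (by omega))
        (fun k hk => ?_) fun k hk => ?_
      · simp only [AlgHom.id_apply, aeval_X, pqExpr_inl, map_sub, collapse_X, skip2_X]
        grind
      · simp only [AlgHom.id_apply, aeval_X, pqExpr_inr, map_sub, collapse_X, skip2_X]
        grind
    · refine hh.algHom_aeval_pqExpr_succ hv (hh.2.1 (m + 1) i (by omega)) (fun k hk => ?_)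
        fun k hk => ?_
      · simp only [mergeP, aeval_X, Sum.elim_inl]
        split_ifs <;> simp only [aeval_X, pqExpr_inl, map_sub, map_add, collapse_X, skip2_X] <;>
          grind
      · simp only [mergeP, aeval_X, Sum.elim_inr]
        split_ifs <;> simp only [aeval_X, pqExpr_inr, map_sub, collapse_X, skip2_X] <;>
          grind

lemma collapse_killVar {n j : ℕ} (hj : j + 1 < n) (p : MvPolynomial ℕ ℂ) :
    collapse j (killVar n p) = killVar n (collapse j p) := by
  suffices h : (collapse j).comp (killVar n) = (killVar n).comp (collapse j) from
    DFunLike.congr_fun h p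
  ext k : 1
  simp only [AlgHom.comp_apply, killVar_X, collapse_X, apply_ite (collapse j), map_zero]
  grind

lemma skip2_killVar {n j : ℕ} (hj : j ≤ n) (p : MvPolynomial ℕ ℂ) :
    skip2 j (killVar n p) = killVar (n + 2) (skip2 j p) := by
  suffices h : (skip2 j).comp (killVar n) = (killVar (n + 2)).comp (skip2 j) from
    DFunLike.congr_fun h p
  ext k : 1
  simp only [AlgHom.comp_apply, killVar_X, skip2_X, apply_ite (skip2 j), map_zero]
  grind

lemma IsSolPQ.isSol_PhiPQtoX {h : PQSeq} (hh : IsSolPQ h) : IsSol (PhiPQtoX h) := by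
  refine ⟨⟨hh.PhiPQtoX_mem_supported, hh.killVar_PhiPQtoX⟩, fun n j hj => ?_⟩
  obtain ⟨n, rfl⟩ := Nat.exists_eq_add_of_le' (show 2 ≤ n by omega)
  rw [Nat.add_sub_cancel]
  obtain ⟨m, rfl | rfl⟩ := n.even_or_odd'
  · rw [PhiPQtoX_even h m, skip2_killVar (by omega), ← hh.collapse_PhiPQtoX_odd (by omega),
      ← collapse_killVar (by omega), show 2 * m + 2 = 2 * (m + 1) by ring, PhiPQtoX_even]
  · exact hh.collapse_PhiPQtoX_odd (by omega)

lemma IsSolPQ.PhiXtoPQ_PhiPQtoX {h : PQSeq} (hh : IsSolPQ h) : PhiXtoPQ (PhiPQtoX h) = h := by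
  funext m
  rw [PhiXtoPQ, PhiPQtoX_odd]
  refine algHom_congr_of_mem_supported (φ := (aeval (xExpr m)).comp (aeval pqExpr))
    (ψ := AlgHom.id ℂ _) (hh.1.1 m) (forall_mem_pqVars (fun k hk => ?_) fun k hk => ?_)
  · simp only [AlgHom.comp_apply, AlgHom.id_apply, aeval_X, pqExpr_inl, map_sub]
    rw [xExpr_even hk.le, xExpr_odd hk.le, pSum_succ]
    ring
  · simp only [AlgHom.comp_apply, AlgHom.id_apply, aeval_X, pqExpr_inr, map_sub]
    rw [show 2 * k + 2 = 2 * (k + 1) by ring, xExpr_even hk, xExpr_odd hk.le, qSum_succ]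
    ring

/-- `Φ_{x→p,q}` maps `Sol` into `Sol'`, `Φ_{p,q→x}` maps `Sol'` into `Sol`,
`Φ_{x→p,q} ∘ Φ_{p,q→x} = Id` on `Sol'`; in particular `Φ_{x→p,q} : Sol → Sol'` is surjective. -/
theorem phi_maps_between_sol_and_solPQ :
    (∀ f, IsSol f → IsSolPQ (PhiXtoPQ f)) ∧
    (∀ h, IsSolPQ h → IsSol (PhiPQtoX h)) ∧
    (∀ h, IsSolPQ h → PhiXtoPQ (PhiPQtoX h) = h) ∧
    (∀ h, IsSolPQ h → ∃ f, IsSol f ∧ PhiXtoPQ f = h) := by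
  exact ⟨fun _ hf => hf.isSolPQ_PhiXtoPQ, fun _ hh => hh.isSol_PhiPQtoX,
    fun _ hh => hh.PhiXtoPQ_PhiPQtoX, fun h hh => ⟨PhiPQtoX h, hh.isSol_PhiPQtoX,
      hh.PhiXtoPQ_PhiPQtoX⟩⟩
end
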